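/- arXiv:1707.07293 — 2 statements merged into one kernel-verified Lean document; each statement's English description precedes it below -/
import Mathlib

section
/- Let G be a finite group and N a normal subgroup with α(G) = α(G/N). If a ∈ G has order 2 modulo N (i.e. the image of a in G/N has order 2), then a centralizes N. In particular, if G/N can be generated by elements of order 2, then N is contained in the center Z(G). -/
open scoped Classical

/-- The number of cyclic subgroups of a group. -/
noncomputable def numCyclic (G : Type*) [Group G] : ℕ :=
  Nat.card {H : Subgroup G // IsCyclic (↥H)}

/-- `alpha G = c(G) / |G|`, the number of cyclic subgroups divided by the order. -/
noncomputable def alpha (G : Type*) [Group G] : ℚ :=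
  (numCyclic G : ℚ) / (Nat.card G : ℚ)

/-- In a finite cyclic subgroup `H`, the number of generators is `φ |H|`. -/
theorem card_zpowers_eq_subgroup {G : Type*} [Group G] [Fintype G] (H : Subgroup G)
    (hH : IsCyclic H) :
    (Finset.univ.filter fun g : G => Subgroup.zpowers g = H).card
      = Nat.totient (Nat.card H) := by
  rw [Nat.card_eq_fintype_card, ← IsCyclic.card_orderOf_eq_totient (α := H) (dvd_refl _)]
  symm
  refine Finset.card_bij (fun x _ => (x : G)) ?_ (fun x _ y _ hxy => Subtype.ext hxy) ?_
  · intro x hx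
    simp only [Finset.mem_filter, Finset.mem_univ, true_and] at hx ⊢
    refine Subgroup.eq_of_le_of_card_ge (Subgroup.zpowers_le.2 x.2) ?_
    rw [Nat.card_zpowers, Subgroup.orderOf_coe, hx, Nat.card_eq_fintype_card]
  · intro g hg
    simp only [Finset.mem_filter, Finset.mem_univ, true_and] at hg
    have hgH : g ∈ H := hg ▸ Subgroup.mem_zpowers g
    refine ⟨⟨g, hgH⟩, ?_, rfl⟩
    simp only [Finset.mem_filter, Finset.mem_univ, true_and, Subgroup.orderOf_mk]
    rw [← Nat.card_zpowers, hg, Nat.card_eq_fintype_card]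

/-- Counting cyclic subgroups by their generators. -/
theorem numCyclic_eq_sum {G : Type*} [Group G] [Fintype G] :
    (numCyclic G : ℚ) = ∑ g : G, ((Nat.totient (orderOf g) : ℚ))⁻¹ := by
  have hmap : ∀ g ∈ (Finset.univ : Finset G), Subgroup.zpowers g ∈
      (Finset.univ.filter fun H : Subgroup G => IsCyclic H) := fun g _ => by
    simp only [Finset.mem_filter, Finset.mem_univ, true_and]
    infer_instance
  rw [← Finset.sum_fiberwise_of_maps_to hmap, numCyclic, Nat.card_eq_fintype_card,
    Fintype.card_subtype, Finset.card_eq_sum_ones, Nat.cast_sum]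
  refine Finset.sum_congr rfl fun H hH => ?_
  have hH' : IsCyclic H := (Finset.mem_filter.1 hH).2
  have hval : ∀ g ∈ Finset.univ.filter (fun g : G => Subgroup.zpowers g = H),
      ((Nat.totient (orderOf g) : ℚ))⁻¹ = ((Nat.totient (Nat.card H) : ℚ))⁻¹ := fun g hg => by
    rw [← Nat.card_zpowers, (Finset.mem_filter.1 hg).2]
  rw [Finset.sum_congr rfl hval, Finset.sum_const, card_zpowers_eq_subgroup H hH', nsmul_eq_mul,
    mul_inv_cancel₀, Nat.cast_one]
  exact_mod_cast (Nat.totient_pos.2 Nat.card_pos).ne'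

/-- Summing over a group a function that factors through a quotient. -/
theorem sum_quotient_mk {G : Type*} [Group G] [Fintype G] (N : Subgroup G) (F : G ⧸ N → ℚ) :
    ∑ g : G, F (g : G ⧸ N) = (Nat.card N : ℚ) * ∑ q : G ⧸ N, F q := by
  rw [← Finset.sum_fiberwise (s := Finset.univ) (g := fun g : G => (g : G ⧸ N)), Finset.mul_sum]
  refine Finset.sum_congr rfl fun q _ => ?_
  have hcard : (Finset.univ.filter fun g : G => (g : G ⧸ N) = q).card = Nat.card N := by
    have := QuotientGroup.card_preimage_mk N {q}
    rw [Nat.card_unique (α := ({q} : Set (G ⧸ N))), mul_one, Nat.card_eq_fintype_card] at this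
    rw [← this, ← Fintype.card_subtype]
    exact Fintype.card_congr (Equiv.refl _)
  rw [Finset.sum_congr rfl fun g hg => by rw [(Finset.mem_filter.1 hg).2], Finset.sum_const,
    hcard, nsmul_eq_mul]

/-- If `α(G) = α(G/N)`, then `φ` takes the same value on the orders of `g` and `gN`. -/
theorem totient_orderOf_eq_of_alpha_eq {G : Type*} [Group G] [Fintype G] (N : Subgroup G)
    [N.Normal] (h : alpha G = alpha (G ⧸ N)) (g : G) :
    Nat.totient (orderOf g) = Nat.totient (orderOf (g : G ⧸ N)) := by
  have hcardN : (Nat.card N : ℚ) ≠ 0 := by exact_mod_cast Nat.card_pos.ne'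
  have hcardQ : (Nat.card (G ⧸ N) : ℚ) ≠ 0 := by exact_mod_cast Nat.card_pos.ne'
  have hle : ∀ x ∈ (Finset.univ : Finset G), ((Nat.totient (orderOf x) : ℚ))⁻¹
      ≤ ((Nat.totient (orderOf (x : G ⧸ N)) : ℚ))⁻¹ := fun x _ => by
    have hdvd : orderOf (x : G ⧸ N) ∣ orderOf x := orderOf_map_dvd (QuotientGroup.mk' N) x
    have hpos : 0 < Nat.totient (orderOf (x : G ⧸ N)) := Nat.totient_pos.2 (orderOf_pos _)
    have hle' := Nat.le_of_dvd (Nat.totient_pos.2 (orderOf_pos x)) (Nat.totient_dvd_of_dvd hdvd)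
    exact inv_anti₀ (by exact_mod_cast hpos) (by exact_mod_cast hle')
  have hsum : ∑ x : G, ((Nat.totient (orderOf x) : ℚ))⁻¹
      = ∑ x : G, ((Nat.totient (orderOf (x : G ⧸ N)) : ℚ))⁻¹ := by
    rw [sum_quotient_mk N fun q => ((Nat.totient (orderOf q) : ℚ))⁻¹, ← numCyclic_eq_sum,
      ← numCyclic_eq_sum]
    rw [alpha, alpha, Subgroup.card_eq_card_quotient_mul_card_subgroup N, Nat.cast_mul] at h
    field_simp at h
    linarith
  have := (Finset.sum_eq_sum_iff_of_le hle).1 hsum g (Finset.mem_univ g)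
  exact_mod_cast inv_injective this

/-- An element whose order has totient `1` squares to `1`. -/
theorem mul_self_eq_one_of_totient_orderOf {G : Type*} [Group G] {g : G}
    (hg : Nat.totient (orderOf g) = 1) : g * g = 1 := by
  rw [← pow_two, ← orderOf_dvd_iff_pow_eq_one]
  rcases Nat.totient_eq_one_iff.1 hg with h | h <;> simp [h]

theorem stmt_8 (G : Type*) [Group G] [Fintype G] (N : Subgroup G) [N.Normal]
    (h : alpha G = alpha (G ⧸ N)) :
    (∀ a : G, orderOf (a : G ⧸ N) = 2 → ∀ n ∈ N, a * n = n * a) ∧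
      (Subgroup.closure {x : G ⧸ N | orderOf x = 2} = ⊤ →
        N ≤ Subgroup.center G) := by
  have hN : ∀ n ∈ N, n * n = 1 := fun n hn => mul_self_eq_one_of_totient_orderOf <| by
    rw [totient_orderOf_eq_of_alpha_eq N h, (QuotientGroup.eq_one_iff n).2 hn, orderOf_one,
      Nat.totient_one]
  have hsq : ∀ a : G, orderOf (a : G ⧸ N) = 2 → a * a = 1 := fun a ha =>
    mul_self_eq_one_of_totient_orderOf <| by
      rw [totient_orderOf_eq_of_alpha_eq N h, ha, Nat.totient_two]
  have hcomm : ∀ a : G, orderOf (a : G ⧸ N) = 2 → ∀ n ∈ N, a * n = n * a := by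
    intro a ha n hn
    have han : orderOf ((a * n : G) : G ⧸ N) = 2 := by
      rw [QuotientGroup.mk_mul_of_mem a hn, ha]
    rw [mul_eq_one_iff_eq_inv.1 (hsq _ han), mul_inv_rev,
      ← mul_eq_one_iff_eq_inv.1 (hN n hn), ← mul_eq_one_iff_eq_inv.1 (hsq a ha)]
  refine ⟨hcomm, fun hgen n hn => Subgroup.mem_center_iff.2 fun g => ?_⟩
  have hNcomm : ∀ m ∈ N, m * n = n * m := fun m hm => by
    have := mul_eq_one_iff_eq_inv.1 (hN _ (N.mul_mem hm hn))
    rw [this, mul_inv_rev, ← mul_eq_one_iff_eq_inv.1 (hN n hn),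
      ← mul_eq_one_iff_eq_inv.1 (hN m hm)]
  have hlift : ∀ x : G ⧸ N, x ∈ Subgroup.closure {x : G ⧸ N | orderOf x = 2} →
      x ∈ (Subgroup.centralizer {n}).map (QuotientGroup.mk' N) := by
    refine fun x hx => (Subgroup.closure_le _).2 ?_ hx
    intro y hy
    obtain ⟨a, rfl⟩ := QuotientGroup.mk_surjective y
    exact ⟨a, Subgroup.mem_centralizer_singleton_iff.2 (hcomm a hy n hn), rfl⟩
  obtain ⟨b, hb, hbg⟩ := hlift g (hgen ▸ Subgroup.mem_top _)
  have hb' : b * n = n * b := Subgroup.mem_centralizer_singleton_iff.1 hb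
  have hm := hNcomm _ (QuotientGroup.eq.1 hbg)
  calc g * n = b * (b⁻¹ * g * n) := by group
    _ = b * n * (b⁻¹ * g) := by rw [hm, mul_assoc]
    _ = n * g := by rw [hb']; group
end

section
/- If G is a finite nilpotent group of order n, then c(G) = Σ_{d | n} B_G(d)/d, where the sum is over all divisors d of n. -/
open scoped Classical

/-- A cyclic subgroup `H` has `φ |H|` generators. -/
theorem card_filter_zpowers_eq {G : Type*} [Group G] [Fintype G] (H : Subgroup G) [IsCyclic H] :
    (Finset.univ.filter fun g : G => Subgroup.zpowers g = H).card = (Nat.card H).totient := by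
  rw [Nat.card_eq_fintype_card, ← IsCyclic.card_orderOf_eq_totient (α := H) dvd_rfl,
    ← Finset.card_map (Function.Embedding.subtype (· ∈ H))]
  congr 1
  ext g
  simp only [Finset.mem_filter, Finset.mem_univ, true_and, Finset.mem_map,
    Function.Embedding.subtype_apply]
  constructor
  · rintro rfl
    refine ⟨⟨g, Subgroup.mem_zpowers g⟩, ?_, rfl⟩
    rw [Subgroup.orderOf_mk, ← Nat.card_eq_fintype_card, Nat.card_zpowers]
  · rintro ⟨a, ha, rfl⟩
    refine Subgroup.eq_of_le_of_card_ge (Subgroup.zpowers_le.2 a.2) ?_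
    rw [Nat.card_zpowers, Subgroup.orderOf_coe, ha, Nat.card_eq_fintype_card]

theorem numCyclic_eq_sum_inv_totient (G : Type*) [Group G] [Fintype G] :
    (numCyclic G : ℚ) = ∑ g : G, ((orderOf g).totient : ℚ)⁻¹ := by
  rw [← Finset.sum_fiberwise_of_maps_to
    (t := Finset.univ.filter fun H : Subgroup G => IsCyclic H) (g := Subgroup.zpowers)
    (fun g _ => by simpa using inferInstanceAs (IsCyclic (Subgroup.zpowers g)))]
  have key : ∀ H ∈ Finset.univ.filter (fun H : Subgroup G => IsCyclic H),
      ∑ g ∈ Finset.univ.filter (fun g : G => Subgroup.zpowers g = H),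
        ((orderOf g).totient : ℚ)⁻¹ = 1 := by
    intro H hH
    have : IsCyclic H := (Finset.mem_filter.1 hH).2
    have hpos : ((Nat.card H).totient : ℚ) ≠ 0 :=
      Nat.cast_ne_zero.2 (Nat.totient_pos.2 Nat.card_pos).ne'
    rw [Finset.sum_congr rfl (g := fun _ => ((Nat.card H).totient : ℚ)⁻¹), Finset.sum_const,
      card_filter_zpowers_eq, nsmul_eq_mul, mul_inv_cancel₀ hpos]
    intro g hg
    rw [← (Finset.mem_filter.1 hg).2, Nat.card_zpowers]
  rw [Finset.sum_congr rfl key, numCyclic, Nat.card_eq_fintype_card, Fintype.card_subtype]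
  simp

/-- The identity `c(G) = ∑ d ∣ |G|, B_G(d) / d`. -/
def CyclicCountFormula (G : Type*) [Group G] : Prop :=
  (numCyclic G : ℚ) =
    ∑ d ∈ (Nat.card G).divisors, (Nat.card {g : G // g ^ d = 1} : ℚ) / (d : ℚ)

namespace CyclicCountFormula

theorem congr {G H : Type*} [Group G] [Group H] [Finite G] [Finite H] (e : G ≃* H)
    (hG : CyclicCountFormula G) : CyclicCountFormula H := by
  have := Fintype.ofFinite G
  have := Fintype.ofFinite H
  have hB (d : ℕ) : Nat.card {g : H // g ^ d = 1} = Nat.card {g : G // g ^ d = 1} :=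
    (Nat.card_congr (e.toEquiv.subtypeEquiv fun g => by simp [← map_pow])).symm
  unfold CyclicCountFormula at hG ⊢
  simp only [hB, ← Nat.card_congr e.toEquiv, ← hG, numCyclic_eq_sum_inv_totient]
  exact (Fintype.sum_equiv e.toEquiv _ _ fun g => by simp).symm

theorem prod {G H : Type*} [Group G] [Group H] [Finite G] [Finite H]
    (hGH : (Nat.card G).Coprime (Nat.card H)) (hG : CyclicCountFormula G)
    (hH : CyclicCountFormula H) : CyclicCountFormula (G × H) := by
  have := Fintype.ofFinite G
  have := Fintype.ofFinite H
  have hc : (numCyclic (G × H) : ℚ) = numCyclic G * numCyclic H := by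
    simp only [numCyclic_eq_sum_inv_totient, Fintype.sum_mul_sum, Fintype.sum_prod_type]
    refine Finset.sum_congr rfl fun g _ => Finset.sum_congr rfl fun h _ => ?_
    have hco : (orderOf g).Coprime (orderOf h) :=
      (hGH.coprime_dvd_left (orderOf_dvd_natCard g)).coprime_dvd_right (orderOf_dvd_natCard h)
    rw [Prod.orderOf, hco.lcm_eq_mul, Nat.totient_mul hco, Nat.cast_mul, mul_inv]
  unfold CyclicCountFormula at *
  rw [hc, hG, hH, Nat.card_prod, Nat.divisors_mul, Finset.mul_def,
    Finset.sum_image hGH.mul_injOn_divisors, Finset.sum_product, Finset.sum_mul_sum]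
  refine Finset.sum_congr rfl fun a ha => Finset.sum_congr rfl fun b hb => ?_
  have ha' := Nat.dvd_of_mem_divisors ha
  have hb' := Nat.dvd_of_mem_divisors hb
  have hpowG (g : G) : g ^ (a * b) = 1 ↔ g ^ a = 1 := by
    have hco : (orderOf g).Coprime b :=
      (hGH.coprime_dvd_left (orderOf_dvd_natCard g)).coprime_dvd_right hb'
    rw [← orderOf_dvd_iff_pow_eq_one, ← orderOf_dvd_iff_pow_eq_one, hco.dvd_mul_right]
  have hpowH (h : H) : h ^ (a * b) = 1 ↔ h ^ b = 1 := by
    have hco : (orderOf h).Coprime a :=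
      (hGH.symm.coprime_dvd_left (orderOf_dvd_natCard h)).coprime_dvd_right ha'
    rw [← orderOf_dvd_iff_pow_eq_one, ← orderOf_dvd_iff_pow_eq_one, hco.dvd_mul_left]
  have hB : Nat.card {x : G × H // x ^ (a * b) = 1} =
      Nat.card {g : G // g ^ a = 1} * Nat.card {h : H // h ^ b = 1} := by
    rw [← Nat.card_prod]
    exact Nat.card_congr ((Equiv.subtypeEquivRight fun x => by
      simp [Prod.ext_iff, hpowG, hpowH]).trans (Equiv.subtypeProdEquivProd
        (p := fun g : G => g ^ a = 1) (q := fun h : H => h ^ b = 1)))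
  rw [hB]
  push_cast
  rw [div_mul_div_comm]

/-- For a divisor `p ^ i` of `p ^ k`, the reciprocals of the multiples of `p ^ i` dividing `p ^ k`
have a closed form. -/
theorem sum_inv_pow_Icc {p i k : ℕ} (hp : p.Prime) (hik : i ≤ k) :
    ∑ j ∈ Finset.Icc i k, ((p : ℚ) ^ j)⁻¹ =
      (((p ^ i).totient : ℚ))⁻¹ - ((p : ℚ) ^ k * (p - 1))⁻¹ +
        if i = 0 then ((p : ℚ) - 1)⁻¹ else 0 := by
  have hp0 : (p : ℚ) ≠ 0 := Nat.cast_ne_zero.2 hp.ne_zero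
  have hp1 : (p : ℚ) - 1 ≠ 0 := sub_ne_zero.2 (by exact_mod_cast hp.one_lt.ne')
  induction k, hik using Nat.le_induction with
  | base =>
    rcases i with _ | i
    · simp
    · rw [Nat.totient_prime_pow_succ hp]
      simp [Nat.cast_sub hp.one_le]
      field_simp
      ring
  | succ k hik ih =>
    rw [Finset.sum_Icc_succ_top (by omega), ih]
    field_simp
    ring

theorem of_isPGroup {G : Type*} [Group G] [Finite G] {p : ℕ} (hp : p.Prime)
    (hG : IsPGroup p G) : CyclicCountFormula G := by
  have := Fintype.ofFinite G
  have := Fact.mk hp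
  obtain ⟨k, hk⟩ := IsPGroup.iff_card.1 hG
  have hp0 : (p : ℚ) ≠ 0 := Nat.cast_ne_zero.2 hp.ne_zero
  have hB (d : ℕ) : (Nat.card {g : G // g ^ d = 1} : ℚ) / d =
      ∑ g : G, if orderOf g ∣ d then ((d : ℚ))⁻¹ else 0 := by
    rw [Nat.card_eq_fintype_card, Fintype.card_subtype, ← Finset.sum_filter, Finset.sum_const,
      nsmul_eq_mul, div_eq_mul_inv]
    simp only [orderOf_dvd_iff_pow_eq_one]
  have hg (g : G) : (∑ d ∈ (Nat.card G).divisors,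
      if orderOf g ∣ d then ((d : ℚ))⁻¹ else 0) = ((orderOf g).totient : ℚ)⁻¹ -
        ((p : ℚ) ^ k * (p - 1))⁻¹ + if g = 1 then ((p : ℚ) - 1)⁻¹ else 0 := by
    obtain ⟨i, hik, hi⟩ := (Nat.dvd_prime_pow hp).1 (hk ▸ orderOf_dvd_natCard g)
    have h1 : g = 1 ↔ i = 0 := by
      rw [← orderOf_eq_one_iff, hi, Nat.pow_eq_one]
      simp [hp.ne_one]
    simp only [h1, hi, ← sum_inv_pow_Icc hp hik, hk, Nat.sum_divisors_prime_pow hp,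
      Nat.pow_dvd_pow_iff_le_right hp.one_lt, ← Finset.sum_filter]
    refine Finset.sum_congr ?_ fun _ _ => by push_cast; rfl
    ext j
    simp
    omega
  unfold CyclicCountFormula
  simp only [hB]
  rw [Finset.sum_comm]
  simp only [hg, Finset.sum_add_distrib, Finset.sum_sub_distrib, Finset.sum_ite_eq',
    Finset.mem_univ, if_true, Finset.sum_const, Finset.card_univ, nsmul_eq_mul]
  rw [numCyclic_eq_sum_inv_totient, ← Nat.card_eq_fintype_card, hk]
  push_cast
  rw [mul_inv, mul_inv_cancel_left₀ (pow_ne_zero k hp0)]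
  ring

/-- The formula holds for a direct product of `p`-groups with pairwise distinct primes. -/
theorem pi {ι : Type*} [Finite ι] (p : ι → ℕ) (hp : ∀ i, (p i).Prime)
    (hinj : Function.Injective p) (P : ι → Type*) [∀ i, Group (P i)] [∀ i, Finite (P i)]
    (hP : ∀ i, IsPGroup (p i) (P i)) : CyclicCountFormula (∀ i, P i) := by
  have hι : Finite ι := inferInstance
  induction ι using Finite.induction_empty_option with
  | of_equiv e ih =>
    let f : (∀ i, P i) ≃* ∀ i, P (e i) :=
      { Equiv.piCongrLeft' P e.symm with map_mul' := fun _ _ => rfl }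
    have := Finite.of_equiv _ e.symm
    exact congr f.symm
      (ih (p ∘ e) (fun _ => hp _) (hinj.comp e.injective) (fun i => P (e i)) (fun _ => hP _) inferInstance)
  | h_empty => exact of_isPGroup Nat.prime_two (IsPGroup.of_subsingleton _ _)
  | @h_option α _ ih =>
    have hcard (i : Option α) : ∃ n, Nat.card (P i) = p i ^ n := by
      have := Fact.mk (hp i)
      exact IsPGroup.iff_card.1 (hP i)
    have hco : (Nat.card (P none)).Coprime (Nat.card (∀ a, P (some a))) := by
      rw [Nat.card_pi]
      refine Nat.Coprime.prod_right fun a _ => ?_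
      obtain ⟨m, hm⟩ := hcard none
      obtain ⟨n, hn⟩ := hcard (some a)
      rw [hm, hn]
      exact Nat.Coprime.pow _ _ ((Nat.coprime_primes (hp _) (hp _)).2
        (hinj.ne (Option.some_ne_none a).symm))
    let e : (∀ i, P i) ≃* P none × ∀ a, P (some a) :=
      { Equiv.piOptionEquivProd with map_mul' := fun _ _ => rfl }
    exact congr e.symm (prod hco (of_isPGroup (hp none) (hP none))
      (ih (p ∘ some) (fun _ => hp _) (hinj.comp (Option.some_injective α)) (fun a => P (some a))
        (fun _ => hP _) inferInstance))

end CyclicCountFormula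

theorem IsPGroup.pi {ι : Type*} [Finite ι] {p : ℕ} {P : ι → Type*} [∀ i, Group (P i)]
    (hP : ∀ i, IsPGroup p (P i)) : IsPGroup p (∀ i, P i) := by
  have := Fintype.ofFinite ι
  intro g
  choose n hn using fun i => hP i (g i)
  refine ⟨∑ i, n i, funext fun i => ?_⟩
  obtain ⟨m, hm⟩ := Nat.exists_eq_add_of_le (Finset.single_le_sum_of_canonicallyOrdered
    (f := n) (Finset.mem_univ i))
  rw [Pi.pow_apply, hm, pow_add, pow_mul, hn, one_pow, Pi.one_apply]

theorem stmt_10 (G : Type*) [Group G] [Fintype G] (hG : Group.IsNilpotent G) :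
    (numCyclic G : ℚ) =
      ∑ d ∈ (Fintype.card G).divisors,
        (Nat.card {g : G // g ^ d = 1} : ℚ) / (d : ℚ) := by
  obtain ⟨e⟩ := ((Group.isNilpotent_of_finite_tfae (G := G)).out 0 4).1 hG
  rw [← Nat.card_eq_fintype_card]
  exact CyclicCountFormula.congr e (CyclicCountFormula.pi (fun p : (Nat.card G).primeFactors => p)
    (fun p => Nat.prime_of_mem_primeFactors p.2) Subtype.val_injective _
    fun _ => IsPGroup.pi fun P => P.isPGroup')
end
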